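/- arXiv:math/0211064 — 2 statements merged into one kernel-verified Lean document; each statement's English description precedes it below -/
import Mathlib

section
/- Let R be a normal Gorenstein domain over k and M a nonzero reflexive R-module. If A = End_R(M) has finite global dimension and A is a maximal Cohen-Macaulay R-module, then A is homologically homogeneous; moreover for R local of dimension n one has gl.dim A ≤ n, and this global dimension equals the injective dimension of A as a right A-module, which is exactly n. -/
open CategoryTheory TensorProduct

noncomputable section

universe u

/-- The `i`-th Ext group of two `A`-modules (`A` an arbitrary ring),
computed in the abelian category `ModuleCat A` (ℤ-linearly). -/
def ExtGrp (A : Type u) [Ring A] (i : ℕ) (M N : ModuleCat.{u} A) : ModuleCat.{u} ℤ :=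
  ((Ext ℤ (ModuleCat.{u} A) i).obj (Opposite.op M)).obj N

/-- A ring `A` has global dimension `≤ n` if all Ext groups vanish in degrees `> n`. -/
def GlobalDimLE (A : Type u) [Ring A] (n : ℕ) : Prop :=
  ∀ (M N : ModuleCat.{u} A) (i : ℕ), n < i → Subsingleton (ExtGrp A i M N)

/-- The global dimension of a ring, as an element of `WithBot (WithTop ℕ)`
(for comparison with `ringKrullDim`); it is `⊤` when no finite bound exists. -/
def globalDim (A : Type u) [Ring A] : WithBot (WithTop ℕ) :=
  sInf {d : WithBot (WithTop ℕ) | ∃ n : ℕ, d = ((n : ℕ∞) : WithBot ℕ∞) ∧ GlobalDimLE A n}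

/-- A module `N` over a ring `A` has injective dimension `≤ n` if `Ext^i(-, N)`
vanishes for all `i > n`. -/
def InjDimLE (A : Type u) [Ring A] (N : ModuleCat.{u} A) (n : ℕ) : Prop :=
  ∀ (M : ModuleCat.{u} A) (i : ℕ), n < i → Subsingleton (ExtGrp A i M N)

/-- The injective dimension of a module. -/
def injDim (A : Type u) [Ring A] (N : ModuleCat.{u} A) : WithBot (WithTop ℕ) :=
  sInf {d : WithBot (WithTop ℕ) | ∃ n : ℕ, d = ((n : ℕ∞) : WithBot ℕ∞) ∧ InjDimLE A N n}

/-- The depth of an `R`-module `M` with respect to an ideal `I` is `≥ n` iff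
`Ext^i(R/I, M) = 0` for all `i < n`. -/
def DepthGE (R : Type u) [CommRing R] (I : Ideal R) (M : ModuleCat.{u} R) (n : ℕ) : Prop :=
  ∀ i : ℕ, i < n → Subsingleton (ExtGrp R i (ModuleCat.of R (R ⧸ I)) M)

/-- A module over a local ring is maximal Cohen-Macaulay if its depth with respect to
the maximal ideal is at least the Krull dimension of the ring. -/
def IsMaximalCM (R : Type u) [CommRing R] [IsLocalRing R] (M : ModuleCat.{u} R) : Prop :=
  ∀ n : ℕ, (n : WithBot (WithTop ℕ)) ≤ ringKrullDim R →
    DepthGE R (IsLocalRing.maximalIdeal R) M n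

/-- A module `M` over an arbitrary commutative ring is maximal Cohen-Macaulay if all its
localizations at primes are. -/
def IsMaximalCMOver (R : Type u) [CommRing R] (M : Type u) [AddCommGroup M] [Module R M] :
    Prop :=
  ∀ P : Ideal R, ∀ _ : P.IsPrime,
    IsMaximalCM (Localization.AtPrime P)
      (ModuleCat.of (Localization.AtPrime P) (LocalizedModule P.primeCompl M))

/-- An `R`-algebra `A` is homologically homogeneous if for every prime `P` of `R`,
the localization `A_P` has global dimension equal to `dim R_P` and is a maximal
Cohen-Macaulay `R_P`-module. -/
def IsHomologicallyHomogeneous (R : Type u) [CommRing R] (A : Type u) [Ring A]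
    [Algebra R A] : Prop :=
  ∀ P : Ideal R, ∀ _ : P.IsPrime,
    globalDim (Localization.AtPrime P ⊗[R] A) = ringKrullDim (Localization.AtPrime P) ∧
    IsMaximalCM (Localization.AtPrime P)
      (ModuleCat.of (Localization.AtPrime P) (Localization.AtPrime P ⊗[R] A))

/-- A commutative noetherian ring is Gorenstein if all its localizations at primes
have finite injective dimension over themselves. -/
def IsGorensteinRing (R : Type u) [CommRing R] : Prop :=
  IsNoetherianRing R ∧
    ∀ P : Ideal R, ∀ _ : P.IsPrime, ∃ n : ℕ,
      InjDimLE (Localization.AtPrime P)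
        (ModuleCat.of (Localization.AtPrime P) (Localization.AtPrime P)) n

open Abelian in
theorem subsingleton_extGrp_iff {A : Type u} [Ring A] (i : ℕ) (M N : ModuleCat.{u} A) :
    Subsingleton (ExtGrp A i M N) ↔ Subsingleton (Ext M N i) := by
  let P := projectiveResolution M
  have h₀ : Subsingleton (ExtGrp A i M N) ↔ (P.complex.linearYonedaObj ℤ N).ExactAt i := by
    rw [HomologicalComplex.exactAt_iff_isZero_homology, ← ModuleCat.isZero_iff_subsingleton]
    exact (P.isoExt i N).isZero_iff
  rw [h₀]
  cases i with
  | zero =>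
    rw [Ext.homEquiv₀.subsingleton_congr,
      HomologicalComplex.exactAt_iff' _ 0 0 1 (by simp) (by simp)]
    rw [ShortComplex.moduleCat_exact_iff]
    obtain ⟨π, hepi, hdπ, hdesc⟩ : ∃ π : P.complex.X 0 ⟶ M, Epi π ∧ P.complex.d 1 0 ≫ π = 0 ∧
        ∀ f : P.complex.X 0 ⟶ N, P.complex.d 1 0 ≫ f = 0 → ∃ g, π ≫ g = f :=
      ⟨P.π.f 0, inferInstanceAs (Epi (P.π.f 0)), P.complex_d_comp_π_f_zero,
        fun f hf => ⟨P.exact₀.desc f hf, P.exact₀.g_desc f hf⟩⟩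
    constructor
    · intro h
      refine subsingleton_of_forall_eq 0 fun f => ?_
      obtain ⟨g, hg⟩ := h (π ≫ f) (by
        change P.complex.d 1 0 ≫ π ≫ f = 0
        rw [← Category.assoc, hdπ, Limits.zero_comp])
      rw [← cancel_epi π, Limits.comp_zero]
      refine hg.symm.trans ?_
      change P.complex.d 0 0 ≫ g = 0
      exact (congrArg (· ≫ (g : P.complex.X 0 ⟶ N)) (P.complex.shape 0 0 (by simp))).trans
        Limits.zero_comp
    · intro h f hf
      obtain ⟨g, rfl⟩ := hdesc f hf
      exact ⟨0, by rw [Subsingleton.elim g 0, map_zero, Limits.comp_zero]; rfl⟩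
  | succ i =>
    rw [HomologicalComplex.exactAt_iff' _ i (i + 1) (i + 2) (by simp) (by simp),
      ShortComplex.moduleCat_exact_iff]
    constructor
    · intro h
      refine subsingleton_of_forall_eq 0 fun α => ?_
      obtain ⟨f, hf, rfl⟩ := P.extMk_surjective α (i + 2) rfl
      rw [P.extMk_eq_zero_iff f (i + 2) rfl hf i rfl]
      exact h f hf
    · intro h f hf
      exact (P.extMk_eq_zero_iff f (i + 2) rfl hf i rfl).mp (Subsingleton.elim _ _)

/-- The group `Ext^i_A(M, N)` vanishes. -/
def ExtVanish (A : Type u) [Ring A] (i : ℕ) (M N : Type u) [AddCommGroup M] [Module A M]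
    [AddCommGroup N] [Module A N] : Prop :=
  Subsingleton (Abelian.Ext (ModuleCat.of A M) (ModuleCat.of A N) i)

namespace ExtVanish

open Abelian

section Ring

variable {A : Type u} [Ring A] {M M₁ M₂ M₃ N N' : Type u}
  [AddCommGroup M] [Module A M] [AddCommGroup M₁] [Module A M₁] [AddCommGroup M₂] [Module A M₂]
  [AddCommGroup M₃] [Module A M₃] [AddCommGroup N] [Module A N] [AddCommGroup N'] [Module A N']
  {f : M₁ →ₗ[A] M₂} {g : M₂ →ₗ[A] M₃}

theorem congr {i : ℕ} (e : M ≃ₗ[A] M₁) (e' : N ≃ₗ[A] N') (h : ExtVanish A i M N) :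
    ExtVanish A i M₁ N' := by
  refine @subsingleton_of_forall_eq _ 0 fun x => ?_
  let a := e.toModuleIso
  let b := e'.toModuleIso
  have h₁ : ((Ext.mk₀ a.hom).comp x (zero_add i)).comp (Ext.mk₀ b.inv) (add_zero i) = 0 :=
    Subsingleton.elim (h := h) _ _
  have h₂ := congrArg (fun y => ((Ext.mk₀ a.inv).comp y (zero_add i)).comp
    (Ext.mk₀ b.hom) (add_zero i)) h₁
  clear_value a b
  simpa using h₂

theorem of_projective [Module.Projective A M] (i : ℕ) : ExtVanish A (i + 1) M N := by
  have : Projective (ModuleCat.of A M) := (IsProjective.iff_projective _).mp ‹_›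
  exact subsingleton_of_forall_eq 0 fun x => Ext.eq_zero_of_projective x

theorem of_subsingleton_left [Subsingleton M] (i : ℕ) : ExtVanish A i M N := by
  have h0 : (𝟙 (ModuleCat.of A M)) = 0 := by ext x; exact Subsingleton.elim (α := M) _ _
  refine @subsingleton_of_forall_eq _ 0 fun x => ?_
  rw [← Ext.mk₀_id_comp x, h0, Ext.mk₀_zero, Ext.zero_comp]

theorem zero_iff : ExtVanish A 0 M N ↔ ∀ f : M →ₗ[A] N, f = 0 := by
  rw [ExtVanish, Ext.homEquiv₀.subsingleton_congr, ModuleCat.homEquiv.subsingleton_congr]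
  exact ⟨fun h f => h.elim _ _, fun h => subsingleton_of_forall_eq 0 h⟩

/-- The short complex attached to an exact pair of maps is short exact. -/
theorem shortExact (hf : Function.Injective f) (hfg : Function.Exact f g)
    (hg : Function.Surjective g) :
    (ModuleCat.shortComplexOfCompEqZero f g hfg.linearMap_comp_eq_zero).ShortExact :=
  ModuleCat.shortComplex_shortExact _ hfg hf hg

section Contravariant

variable (hf : Function.Injective f) (hfg : Function.Exact f g) (hg : Function.Surjective g)

include hf hfg hg

theorem left_middle {i : ℕ} (h₁ : ExtVanish A i M₁ N) (h₃ : ExtVanish A i M₃ N) :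
    ExtVanish A i M₂ N := by
  refine @subsingleton_of_forall_eq _ 0 fun x => ?_
  obtain ⟨y, rfl⟩ := Ext.contravariant_sequence_exact₂ (shortExact hf hfg hg) _ x
    (Subsingleton.elim (h := h₁) _ _)
  rw [Subsingleton.elim (h := h₃) y 0, Ext.comp_zero]

theorem left_right {i : ℕ} (h₁ : ExtVanish A i M₁ N) (h₂ : ExtVanish A (i + 1) M₂ N) :
    ExtVanish A (i + 1) M₃ N := by
  refine @subsingleton_of_forall_eq _ 0 fun x => ?_
  obtain ⟨y, rfl⟩ := Ext.contravariant_sequence_exact₃ (shortExact hf hfg hg) _ x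
    (Subsingleton.elim (h := h₂) _ _) (add_comm 1 i)
  rw [Subsingleton.elim (h := h₁) y 0, Ext.comp_zero]

theorem left_left {i : ℕ} (h₂ : ExtVanish A i M₂ N) (h₃ : ExtVanish A (i + 1) M₃ N) :
    ExtVanish A i M₁ N := by
  refine @subsingleton_of_forall_eq _ 0 fun x => ?_
  obtain ⟨y, rfl⟩ := Ext.contravariant_sequence_exact₁ (shortExact hf hfg hg) _ x (add_comm 1 i)
    (Subsingleton.elim (h := h₃) _ _)
  rw [Subsingleton.elim (h := h₂) y 0, Ext.comp_zero]

theorem right_middle {i : ℕ} (h₁ : ExtVanish A i N M₁) (h₃ : ExtVanish A i N M₃) :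
    ExtVanish A i N M₂ := by
  refine @subsingleton_of_forall_eq _ 0 fun x => ?_
  obtain ⟨y, rfl⟩ := Ext.covariant_sequence_exact₂ _ (shortExact hf hfg hg) x
    (Subsingleton.elim (h := h₃) _ _)
  rw [Subsingleton.elim (h := h₁) y 0, Ext.zero_comp]

theorem right_right {i : ℕ} (h₁ : ExtVanish A (i + 1) N M₁) (h₂ : ExtVanish A i N M₂) :
    ExtVanish A i N M₃ := by
  refine @subsingleton_of_forall_eq _ 0 fun x => ?_
  obtain ⟨y, rfl⟩ := Ext.covariant_sequence_exact₃ _ (shortExact hf hfg hg) x rfl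
    (Subsingleton.elim (h := h₁) _ _)
  rw [Subsingleton.elim (h := h₂) y 0, Ext.zero_comp]

theorem right_left {i : ℕ} (h₂ : ExtVanish A (i + 1) N M₂) (h₃ : ExtVanish A i N M₃) :
    ExtVanish A (i + 1) N M₁ := by
  refine @subsingleton_of_forall_eq _ 0 fun x => ?_
  obtain ⟨y, rfl⟩ := Ext.covariant_sequence_exact₁ _ (shortExact hf hfg hg) x
    (Subsingleton.elim (h := h₂) _ _) rfl
  rw [Subsingleton.elim (h := h₃) y 0, Ext.zero_comp]

/-- If `Ext^1(M₃, N) = 0` then maps `M₁ → N` extend to `M₂`. -/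
theorem exists_extension (h : ExtVanish A 1 M₃ N) (φ : M₁ →ₗ[A] N) :
    ∃ ψ : M₂ →ₗ[A] N, ψ ∘ₗ f = φ := by
  obtain ⟨y, hy⟩ := Ext.contravariant_sequence_exact₁ (shortExact hf hfg hg) _
    (Ext.mk₀ (ModuleCat.ofHom φ : ModuleCat.of A M₁ ⟶ ModuleCat.of A N)) (add_comm 1 0)
    (Subsingleton.elim (h := h) _ _)
  obtain ⟨ψ, rfl⟩ := Ext.homEquiv₀.symm.surjective y
  refine ⟨ψ.hom, ?_⟩
  have h2 : Ext.mk₀ ((ModuleCat.shortComplexOfCompEqZero f g hfg.linearMap_comp_eq_zero).f ≫ ψ)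
      = Ext.mk₀ (ModuleCat.ofHom φ : ModuleCat.of A M₁ ⟶ ModuleCat.of A N) := by
    rw [← hy]; simp
  exact congrArg ModuleCat.Hom.hom ((Ext.mk₀_bijective _ _).1 h2)

/-- If maps `M₁ → N` extend to `M₂` and `Ext^1(M₂, N) = 0`, then `Ext^1(M₃, N) = 0`. -/
theorem one_of_extension (h₂ : ExtVanish A 1 M₂ N)
    (h : ∀ φ : M₁ →ₗ[A] N, ∃ ψ : M₂ →ₗ[A] N, ψ ∘ₗ f = φ) : ExtVanish A 1 M₃ N := by
  refine @subsingleton_of_forall_eq _ 0 fun x => ?_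
  obtain ⟨y, rfl⟩ := Ext.contravariant_sequence_exact₃ (shortExact hf hfg hg) _ x
    (Subsingleton.elim (h := h₂) _ _) (add_comm 1 0)
  obtain ⟨φ, rfl⟩ := Ext.homEquiv₀.symm.surjective y
  obtain ⟨ψ, hψ⟩ := h φ.hom
  have h2 : φ = (ModuleCat.shortComplexOfCompEqZero f g hfg.linearMap_comp_eq_zero).f ≫
      (ModuleCat.ofHom ψ : ModuleCat.of A M₂ ⟶ ModuleCat.of A N) := by
    ext x; exact (congrArg (fun l => l x) hψ).symm
  rw [h2]
  change (shortExact hf hfg hg).extClass.comp (Ext.mk₀ _) _ = 0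
  rw [← Ext.mk₀_comp_mk₀]
  exact (shortExact hf hfg hg).extClass_comp_assoc _

end Contravariant

theorem exact_ker (g : M₂ →ₗ[A] M₃) : Function.Exact (LinearMap.ker g).subtype g :=
  LinearMap.exact_subtype_ker_map g

/-- Dimension shifting in the first variable along a surjection from a projective module. -/
theorem shift_iff [Module.Projective A M₂] {g : M₂ →ₗ[A] M₃} (hg : Function.Surjective g)
    (i : ℕ) : ExtVanish A (i + 1) (LinearMap.ker g) N ↔ ExtVanish A (i + 2) M₃ N :=
  ⟨fun h => left_right (Submodule.subtype_injective _) (exact_ker g) hg h (of_projective _),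
    fun h => left_left (Submodule.subtype_injective _) (exact_ker g) hg (of_projective _) h⟩

end Ring

open Abelian IsLocalRing

section Bridge

variable {A : Type u} [Ring A]

theorem of_succ {X : Type u} [AddCommGroup X] [Module A X] {n : ℕ}
    (h : ∀ (M : Type u) [AddCommGroup M] [Module A M], ExtVanish A (n + 1) M X)
    (M : Type u) [AddCommGroup M] [Module A M] {i : ℕ} (hi : n < i) : ExtVanish A i M X := by
  obtain ⟨j, rfl⟩ := Nat.exists_eq_add_of_lt hi
  clear hi
  induction j generalizing M with
  | zero => exact h M
  | succ j ih =>
    have hs : Function.Surjective (Finsupp.linearCombination A (id : M → M)) :=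
      Finsupp.linearCombination_id_surjective A M
    exact (shift_iff hs (n + j)).mp (ih _)

theorem injDimLE_iff {X : Type u} [AddCommGroup X] [Module A X] {n : ℕ} :
    InjDimLE A (ModuleCat.of A X) n ↔
      ∀ (M : Type u) [AddCommGroup M] [Module A M], ExtVanish A (n + 1) M X := by
  constructor
  · intro h M _ _
    exact (subsingleton_extGrp_iff _ _ _).mp (h (ModuleCat.of A M) (n + 1) n.lt_succ_self)
  · intro h M i hi
    exact (subsingleton_extGrp_iff _ _ _).mpr (of_succ h M hi)

theorem globalDimLE_iff {n : ℕ} :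
    GlobalDimLE A n ↔ ∀ (M X : Type u) [AddCommGroup M] [Module A M]
      [AddCommGroup X] [Module A X], ExtVanish A (n + 1) M X := by
  constructor
  · intro h M X _ _ _ _
    exact (subsingleton_extGrp_iff _ _ _).mp
      (h (ModuleCat.of A M) (ModuleCat.of A X) (n + 1) n.lt_succ_self)
  · intro h M X i hi
    exact (subsingleton_extGrp_iff _ _ _).mpr (of_succ (X := X) (fun M => h M X) M hi)

end Bridge

section Local

variable {R : Type u} [CommRing R] [IsNoetherianRing R] [IsLocalRing R]

/-- Nakayama's lemma for `Ext`. -/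
theorem of_quotSMulTop {N X : Type u} [AddCommGroup N] [Module R N] [Module.Finite R N]
    [AddCommGroup X] [Module R X] [Module.Finite R X] {y : R} (hy : y ∈ maximalIdeal R)
    (reg : IsSMulRegular N y) {i : ℕ} (h : ExtVanish R (i + 1) (QuotSMulTop y N) X) :
    ExtVanish R i N X := by
  have hS := IsSMulRegular.smulShortComplex_shortExact (M := ModuleCat.of R N) reg
  have key : ∀ x : Ext (ModuleCat.of R N) (ModuleCat.of R X) i, ∃ x', y • x' = x := by
    intro x
    obtain ⟨x', hx'⟩ := Ext.contravariant_sequence_exact₁ hS _ x (add_comm 1 i)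
      (Subsingleton.elim (h := h) _ _)
    refine ⟨x', ?_⟩
    have h₁ (z : Ext (ModuleCat.of R N) (ModuleCat.of R X) i) :
        y • z = (Ext.mk₀ (y • 𝟙 (ModuleCat.of R N))).comp z (zero_add i) := by
      rw [Ext.mk₀_smul, Ext.smul_comp, Ext.mk₀_id_comp]
    exact (h₁ x').trans hx'
  have hfin : Module.Finite R (Ext (ModuleCat.of R N) (ModuleCat.of R X) i) := inferInstance
  have hbot : (⊤ : Submodule R (Ext (ModuleCat.of R N) (ModuleCat.of R X) i)) = ⊥ :=
    Submodule.eq_bot_of_le_smul_of_le_jacobson_bot (maximalIdeal R) _ hfin.fg_top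
      (fun x _ => by
        obtain ⟨x', rfl⟩ := key x
        exact Submodule.smul_mem_smul hy trivial)
      (IsLocalRing.maximalIdeal_le_jacobson _)
  exact (Submodule.subsingleton_iff R).mp (subsingleton_of_bot_eq_top hbot.symm)

variable (R) in
/-- A finite module of projective dimension at most `dim R` containing the residue field. -/
theorem exists_embedding_residue {n : ℕ} (hn : ringKrullDim R = n) :
    ∃ (Q : Type u) (_ : AddCommGroup Q) (_ : Module R Q) (_ : Module.Finite R Q)
      (f : (R ⧸ maximalIdeal R) →ₗ[R] Q), Function.Injective f ∧
      ∀ (X : Type u) [AddCommGroup X] [Module R X] (i : ℕ), n < i → ExtVanish R i Q X := by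
  suffices H : ∀ (d s : ℕ) (Q : Type u) [AddCommGroup Q] [Module R Q] [Module.Finite R Q]
      [Nontrivial Q], d + s = n → Module.supportDim R Q ≤ d →
      (∀ (X : Type u) [AddCommGroup X] [Module R X] (i : ℕ), s < i → ExtVanish R i Q X) →
      ∃ (Q : Type u) (_ : AddCommGroup Q) (_ : Module R Q) (_ : Module.Finite R Q)
      (f : (R ⧸ maximalIdeal R) →ₗ[R] Q), Function.Injective f ∧
      ∀ (X : Type u) [AddCommGroup X] [Module R X] (i : ℕ), n < i → ExtVanish R i Q X by
    refine H n 0 R (by simp) (by rw [Module.supportDim_self_eq_ringKrullDim, hn]) ?_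
    intro X _ _ i hi
    obtain ⟨i, rfl⟩ := Nat.exists_eq_add_of_lt hi
    exact of_projective _
  intro d
  induction d using Nat.strong_induction_on with
  | h d ih =>
    intro s Q _ _ _ _ hs hd hQ
    by_cases hsub : Subsingleton ((R ⧸ maximalIdeal R) →ₗ[R] Q)
    · obtain ⟨y, hy, reg⟩ := IsSMulRegular.subsingleton_linearMap_iff.mp hsub
      rw [Ideal.annihilator_quotient] at hy
      have : Nontrivial (QuotSMulTop y Q) := nontrivial_quotSMulTop_of_mem_maximalIdeal Q hy
      have hdim := Module.supportDim_quotSMulTop_succ_eq_supportDim reg hy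
      obtain ⟨a, ha⟩ : ∃ a : ℕ∞, Module.supportDim R (QuotSMulTop y Q) = a :=
        (WithBot.ne_bot_iff_exists.mp
          (Module.supportDim_ne_bot_of_nontrivial R (QuotSMulTop y Q))).imp fun _ h => h.symm
      rw [← hdim, ha] at hd
      have had : a + 1 ≤ d := by exact_mod_cast hd
      obtain ⟨e, rfl⟩ := ENat.ne_top_iff_exists.mp
        (ne_top_of_le_ne_top (ENat.natCast_ne_top d) (le_self_add.trans had))
      have hed : e + 1 ≤ d := by exact_mod_cast had
      refine ih (d - 1) (by lia) (s + 1) (QuotSMulTop y Q) (by lia) ?_ ?_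
      · rw [ha]
        exact WithBot.coe_le_coe.mpr (Nat.cast_le.mpr (show e ≤ d - 1 by lia))
      · intro X _ _ i hi
        obtain ⟨i, rfl⟩ := Nat.exists_eq_add_of_lt hi
        exact left_right (f := LinearMap.lsmul R Q y) reg (LinearMap.exact_lsmul_mkQ_smul_top Q y)
          (Submodule.mkQ_surjective _) (hQ X _ (by lia)) (hQ X _ (by lia))
    · rw [not_subsingleton_iff_nontrivial] at hsub
      obtain ⟨f, hf⟩ := exists_ne (0 : (R ⧸ maximalIdeal R) →ₗ[R] Q)
      refine ⟨Q, _, _, inferInstance, f, ?_, fun X _ _ i hi => hQ X i (by lia)⟩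
      have := (isSimpleModule_iff_isCoatom (R := R) (m := maximalIdeal R)).mpr
        (maximalIdeal.isMaximal R).out
      exact (LinearMap.injective_or_eq_zero f).resolve_right hf

/-- A local ring of finite injective dimension has injective dimension at most its
Krull dimension, tested on finite modules. -/
theorem of_finite_of_injDim {n t : ℕ} (hn : ringKrullDim R = n)
    (ht : ∀ (M : Type u) [AddCommGroup M] [Module R M], ExtVanish R (t + 1) M R)
    {i : ℕ} (hi : n < i) (N : Type u) [AddCommGroup N] [Module R N] [Module.Finite R N] :
    ExtVanish R i N R := by
  obtain ⟨Q, _, _, _, f, hf, hQ⟩ := exists_embedding_residue R hn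
  by_cases hit : t < i
  · exact of_succ ht N hit
  obtain ⟨j, hj⟩ : ∃ j, i + j = t + 1 := ⟨t + 1 - i, by lia⟩
  clear hit
  induction j generalizing i N with
  | zero => obtain rfl : i = t + 1 := hj; exact ht N
  | succ j ih =>
    induction ‹Module.Finite R N› using
      IsNoetherianRing.induction_on_isQuotientEquivQuotientPrime R with
    | subsingleton N => exact of_subsingleton_left i
    | exact N₁ N₂ N₃ f g hf hg hfg h₁ h₃ => exact left_middle hf hfg hg h₁ h₃
    | quotient N p e =>
      refine congr e.symm (LinearEquiv.refl R R) ?_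
      by_cases hp : p.1 = maximalIdeal R
      · rw [hp]
        exact left_left hf (LinearMap.exact_map_mkQ_range f) (Submodule.mkQ_surjective _)
          (hQ R i hi) (ih (by lia) _ (by lia))
      · obtain ⟨y, hy, hyp⟩ := Set.not_subset.mp
          (fun h => hp (le_antisymm (le_maximalIdeal p.2.ne_top) h))
        refine of_quotSMulTop hy ?_ (ih (by lia) _ (by lia))
        rw [isSMulRegular_quotient_iff_mem_of_smul_mem]
        intro x hx
        exact (p.2.mem_or_mem hx).resolve_left hyp

end Local
open IsLocalRing Pointwise

section Pi

variable {A : Type u} [Ring A] {M N : Type u} [AddCommGroup M] [Module A M]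
  [AddCommGroup N] [Module A N]

theorem prod_left {i : ℕ} {M' : Type u} [AddCommGroup M'] [Module A M']
    (h : ExtVanish A i M N) (h' : ExtVanish A i M' N) : ExtVanish A i (M × M') N :=
  left_middle (f := LinearMap.inl A M M') (g := LinearMap.snd A M M') LinearMap.inl_injective
    .inl_snd LinearMap.snd_surjective h h'

theorem prod_right {i : ℕ} {N' : Type u} [AddCommGroup N'] [Module A N']
    (h : ExtVanish A i M N) (h' : ExtVanish A i M N') : ExtVanish A i M (N × N') :=
  right_middle (f := LinearMap.inl A N N') (g := LinearMap.snd A N N') LinearMap.inl_injective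
    .inl_snd LinearMap.snd_surjective h h'

theorem of_subsingleton_right [Subsingleton N] (i : ℕ) : ExtVanish A i M N := by
  have h0 : (𝟙 (ModuleCat.of A N)) = 0 := by ext x; exact Subsingleton.elim (α := N) _ _
  refine @subsingleton_of_forall_eq _ 0 fun x => ?_
  rw [← Abelian.Ext.comp_mk₀_id x, h0, Abelian.Ext.mk₀_zero, Abelian.Ext.comp_zero]

theorem pi_left {i : ℕ} (h : ExtVanish A i M N) (r : ℕ) : ExtVanish A i (Fin r → M) N := by
  induction r with
  | zero => exact of_subsingleton_left i
  | succ r ih =>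
    exact congr (Fin.consLinearEquiv A fun _ : Fin (r + 1) => M) (.refl A N) (prod_left h ih)

theorem pi_right {i : ℕ} (h : ExtVanish A i M N) (r : ℕ) : ExtVanish A i M (Fin r → N) := by
  induction r with
  | zero => exact of_subsingleton_right i
  | succ r ih =>
    exact congr (.refl A M) (Fin.consLinearEquiv A fun _ : Fin (r + 1) => N) (prod_right h ih)

end Pi

variable {R : Type u} [CommRing R] [IsNoetherianRing R]
  {B : Type u} [Ring B] [Algebra R B]

/-- If `Ext^i_R(-, X)` vanishes for `i > m` on finite `B`-modules, then it vanishes on those of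
depth `d` as soon as `i + d > m`. -/
theorem of_depth [IsLocalRing R] {X : Type u} [AddCommGroup X] [Module R X] [Module.Finite R X]
    {m : ℕ}
    (hB : ∀ (N : Type u) [AddCommGroup N] [Module R N] [Module B N] [IsScalarTower R B N]
      [Module.Finite R N] (i : ℕ), m < i → ExtVanish R i N X)
    {d i : ℕ} (hi : m < i + d) (N : Type u) [AddCommGroup N] [Module R N] [Module B N]
    [IsScalarTower R B N] [Module.Finite R N]
    (hN : ∀ j < d, ExtVanish R j (R ⧸ maximalIdeal R) N) : ExtVanish R i N X := by
  induction d generalizing i N with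
  | zero => exact hB N i hi
  | succ d ih =>
    have hsub : Subsingleton ((R ⧸ maximalIdeal R) →ₗ[R] N) :=
      subsingleton_of_forall_eq 0 (zero_iff.mp (hN 0 d.succ_pos))
    obtain ⟨y, hy, reg⟩ := IsSMulRegular.subsingleton_linearMap_iff.mp hsub
    rw [Ideal.annihilator_quotient] at hy
    have : SMulCommClass R B N := IsScalarTower.to_smulCommClass
    let e : QuotSMulTop y N ≃ₗ[R] N ⧸ (y • ⊤ : Submodule B N) :=
      (Submodule.quotEquivOfEq _ _ (by ext x; simp [Submodule.mem_smul_pointwise_iff_exists])) ≪≫ₗ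
        Submodule.Quotient.restrictScalarsEquiv R (y • ⊤ : Submodule B N)
    refine of_quotSMulTop hy reg (congr e.symm (.refl R X) (ih (by lia) _ fun j hj => ?_))
    exact congr (.refl R _) e (right_right (f := LinearMap.lsmul R N y) reg
      (LinearMap.exact_lsmul_mkQ_smul_top N y) (Submodule.mkQ_surjective _)
      (hN (j + 1) (by lia)) (hN j (by lia)))

section Dual

variable {τ : B →ₗ[R] R}
  (hτ : Function.Bijective fun b : B => τ ∘ₗ LinearMap.mulRight R b)
include hτ

omit [IsNoetherianRing R] in
theorem eq_of_dual {a b : B} (h : ∀ c, τ (c * a) = τ (c * b)) : a = b :=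
  hτ.1 (LinearMap.ext h)

omit [IsNoetherianRing R] in
theorem exists_lift_dual {N : Type u} [AddCommGroup N] [Module R N] [Module B N]
    [IsScalarTower R B N] (ψ : N →ₗ[R] R) : ∃ φ : N →ₗ[B] B, ∀ x, τ (φ x) = ψ x := by
  choose b hb using fun x : N => hτ.2 (ψ ∘ₗ (LinearMap.toSpanSingleton B N x).restrictScalars R)
  have hb' : ∀ x c, τ (c * b x) = ψ (c • x) := fun x c => LinearMap.congr_fun (hb x) c
  refine ⟨⟨⟨b, fun x y => eq_of_dual hτ fun c => ?_⟩, fun d x => eq_of_dual hτ fun c => ?_⟩,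
    fun x => by simpa using hb' x 1⟩
  · rw [mul_add, map_add, hb', hb', hb', smul_add, map_add]
  · rw [RingHom.id_apply, smul_eq_mul, ← mul_assoc, hb', hb', mul_smul]

omit [IsNoetherianRing R] in
theorem eq_of_comp_dual {N : Type u} [AddCommGroup N] [Module B N]
    {φ φ' : N →ₗ[B] B} (h : ∀ x, τ (φ x) = τ (φ' x)) : φ = φ' := by
  ext x
  refine eq_of_dual hτ fun c => ?_
  rw [← smul_eq_mul, ← smul_eq_mul, ← map_smul, ← map_smul, h]

/-- Change of rings: over a symmetric-type algebra `B ≅ Hom_R(B, R)` one has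
`Ext_B^i(N, B) = Ext_R^i(N, R)`. -/
theorem iff_of_dual [Module.Finite R B] (hB : ∀ j, ExtVanish R (j + 1) B R) (i : ℕ)
    (N : Type u) [AddCommGroup N] [Module R N] [Module B N] [IsScalarTower R B N]
    [Module.Finite R N] : ExtVanish B (i + 1) N B ↔ ExtVanish R (i + 1) N R := by
  have : IsNoetherianRing B := isNoetherian_of_tower R inferInstance
  induction i generalizing N with
  | zero =>
    have : Module.Finite B N := Module.Finite.of_restrictScalars_finite R B N
    obtain ⟨r, g, hg⟩ := Module.Finite.exists_fin' B N
    let f := (LinearMap.ker g).subtype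
    have hf : Function.Injective f := Submodule.subtype_injective _
    have hfg : Function.Exact f g := exact_ker g
    constructor
    · intro h
      refine one_of_extension (f := f.restrictScalars R) (g := g.restrictScalars R) hf hfg hg
        (pi_left (hB 0) r) fun ψ => ?_
      obtain ⟨φ, hφ⟩ := exists_lift_dual hτ ψ
      obtain ⟨φ', hφ'⟩ := exists_extension hf hfg hg h φ
      refine ⟨τ ∘ₗ φ'.restrictScalars R, LinearMap.ext fun x => ?_⟩
      rw [← hφ, ← hφ']
      rfl
    · intro h
      refine one_of_extension hf hfg hg (of_projective 0) fun φ => ?_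
      obtain ⟨ψ, hψ⟩ := exists_extension (f := f.restrictScalars R) (g := g.restrictScalars R)
        hf hfg hg h (τ ∘ₗ φ.restrictScalars R)
      obtain ⟨φ', hφ'⟩ := exists_lift_dual hτ ψ
      refine ⟨φ', eq_of_comp_dual hτ fun x => ?_⟩
      rw [LinearMap.comp_apply, hφ']
      exact LinearMap.congr_fun hψ x
  | succ i ih =>
    have : Module.Finite B N := Module.Finite.of_restrictScalars_finite R B N
    obtain ⟨r, g, hg⟩ := Module.Finite.exists_fin' B N
    have : Module.Finite R (LinearMap.ker g) := Module.Finite.trans B _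
    refine (shift_iff hg i).symm.trans ((ih (LinearMap.ker g)).trans ?_)
    have hf : Function.Injective ((LinearMap.ker g).subtype.restrictScalars R) :=
      Submodule.subtype_injective _
    have hfg : Function.Exact ((LinearMap.ker g).subtype.restrictScalars R)
      (g.restrictScalars R) := exact_ker g
    exact ⟨fun h => left_right hf hfg hg h (pi_left (hB (i + 1)) r),
      fun h => left_left hf hfg hg (pi_left (hB i) r) h⟩

end Dual

section Dimension

variable {B : Type u} [Ring B]

theorem of_injective {N E : Type u} [AddCommGroup N] [Module B N] [AddCommGroup E] [Module B E]
    [Module.Injective B E] (i : ℕ) : ExtVanish B (i + 1) N E := by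
  have : Injective (ModuleCat.of B E) := Module.injective_object_of_injective_module B E
  exact subsingleton_of_forall_eq 0 fun x => Abelian.Ext.eq_zero_of_injective x

/-- Baer's criterion in higher degrees. -/
theorem of_ideal {n : ℕ} {X : Type u} [AddCommGroup X] [Module B X]
    (h : ∀ I : Ideal B, ExtVanish B (n + 1) (B ⧸ I) X)
    (M : Type u) [AddCommGroup M] [Module B M] : ExtVanish B (n + 1) M X := by
  induction n generalizing X with
  | zero =>
    have hX : Module.Baer B X := fun I φ => by
      obtain ⟨ψ, hψ⟩ := exists_extension (f := I.subtype) (g := I.mkQ)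
        (Submodule.subtype_injective I) (LinearMap.exact_subtype_mkQ I)
        (Submodule.mkQ_surjective I) (h I) φ
      exact ⟨ψ, fun x hx => LinearMap.congr_fun hψ ⟨x, hx⟩⟩
    have := hX.injective
    exact of_injective 0
  | succ n ih =>
    obtain ⟨E, hE, ι, hι⟩ : ∃ (E : ModuleCat.{u} B) (_ : Injective E) (ι : ModuleCat.of B X ⟶ E),
      Mono ι := ⟨Injective.under _, inferInstance, Injective.ι _, inferInstance⟩
    have hinj : Function.Injective ι.hom := (ModuleCat.mono_iff_injective ι).mp hι
    have : Module.Injective B E := 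
      Module.injective_module_of_injective_object (inj := hE)
    refine right_left hinj (LinearMap.exact_map_mkQ_range ι.hom) (Submodule.mkQ_surjective _)
      (of_injective (n + 1)) (ih fun I => ?_)
    exact right_right hinj (LinearMap.exact_map_mkQ_range ι.hom) (Submodule.mkQ_surjective _)
      (h I) (of_injective n)

theorem finsupp_right [IsNoetherianRing B] {X : Type u} [AddCommGroup X] [Module B X] (ι : Type u)
    {i : ℕ} {N : Type u} [AddCommGroup N]
    [Module B N] [Module.Finite B N] (h : ExtVanish B (i + 1) N X) :
    ExtVanish B (i + 1) N (ι →₀ X) := by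
  induction i generalizing N with
  | zero =>
    obtain ⟨r, g, hg⟩ := Module.Finite.exists_fin' B N
    refine one_of_extension (Submodule.subtype_injective _) (exact_ker g) hg (of_projective 0)
      fun φ => ?_
    obtain ⟨s, hs⟩ : ∃ s : Finset ι, LinearMap.range φ ≤ Finsupp.supported X B (s : Set ι) := by
      classical
      obtain ⟨t, ht⟩ := (IsNoetherian.noetherian (⊤ : Submodule B (LinearMap.ker g)))
      refine ⟨t.biUnion fun x => (φ x).support, ?_⟩
      rw [LinearMap.range_eq_map, ← ht, Submodule.map_span_le]
      intro x hx
      rw [Finsupp.mem_supported]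
      intro j hj
      exact Finset.mem_coe.mpr (Finset.mem_biUnion.mpr ⟨x, hx, hj⟩)
    have hV : ExtVanish B 1 N (Finsupp.supported X B (s : Set ι)) :=
      congr (.refl B N) ((LinearEquiv.funCongrLeft B X s.equivFin) ≪≫ₗ
        (Finsupp.linearEquivFunOnFinite B X s).symm ≪≫ₗ
        (Finsupp.supportedEquivFinsupp (s : Set ι)).symm) (pi_right h s.card)
    obtain ⟨ψ, hψ⟩ := exists_extension (Submodule.subtype_injective _) (exact_ker g) hg hV
      (φ.codRestrict _ fun x => hs ⟨x, rfl⟩)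
    refine ⟨Submodule.subtype _ ∘ₗ ψ, ?_⟩
    rw [LinearMap.comp_assoc, hψ, LinearMap.subtype_comp_codRestrict]
  | succ i ih =>
    obtain ⟨r, g, hg⟩ := Module.Finite.exists_fin' B N
    exact (shift_iff hg i).mp (ih ((shift_iff hg i).mpr h))

/-- A noetherian ring of finite global dimension has global dimension at most its injective
dimension. -/
theorem of_globalDim_of_injDim [IsNoetherianRing B] {g n : ℕ}
    (hg : ∀ (M X : Type u) [AddCommGroup M] [Module B M] [AddCommGroup X] [Module B X],
      ExtVanish B (g + 1) M X)
    (hn : ∀ (M : Type u) [AddCommGroup M] [Module B M], ExtVanish B (n + 1) M B)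
    (M X : Type u) [AddCommGroup M] [Module B M] [AddCommGroup X] [Module B X] :
    ExtVanish B (n + 1) M X := by
  suffices H : ∀ (j i : ℕ), n < i → i + j = max g n + 1 → ∀ (N X : Type u) [AddCommGroup N]
      [Module B N] [Module.Finite B N] [AddCommGroup X] [Module B X], ExtVanish B i N X from
    of_ideal (fun I => H (max g n - n) (n + 1) n.lt_succ_self (by lia) (B ⧸ I) X) M
  intro j
  induction j with
  | zero =>
    intro i _ hi N X _ _ _ _ _
    exact of_succ (hg · X) N (by lia)
  | succ j ih =>
    intro i hni hi N X _ _ _ _ _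
    obtain ⟨i, rfl⟩ : ∃ i', i = i' + 1 := ⟨i - 1, by lia⟩
    have hs : Function.Surjective (Finsupp.linearCombination B (id : X → X)) :=
      Finsupp.linearCombination_id_surjective B X
    exact right_right (Submodule.subtype_injective _) (exact_ker _) hs
      (ih _ (by lia) (by lia) N _) (finsupp_right X (of_succ hn N hni))

end Dimension

open IsLocalRing

section Gorenstein

variable {R : Type u} [CommRing R] [IsNoetherianRing R] [IsLocalRing R]
  {B : Type u} [Ring B] [Algebra R B] [Module.Finite R B] {n t : ℕ}
  {τ : B →ₗ[R] R}

theorem succ_of_dual (hn : ringKrullDim R = n)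
    (hR : ∀ (M : Type u) [AddCommGroup M] [Module R M], ExtVanish R (t + 1) M R)
    (hτ : Function.Bijective fun b : B => τ ∘ₗ LinearMap.mulRight R b)
    (hB : ∀ j < n, ExtVanish R j (R ⧸ maximalIdeal R) B)
    (M : Type u) [AddCommGroup M] [Module B M] : ExtVanish B (n + 1) M B := by
  have hB' (j : ℕ) : ExtVanish R (j + 1) B R :=
    of_depth (B := R) (m := n)
      (fun N _ h _ _ _ i hi => @of_finite_of_injDim R _ _ _ n t hn hR i hi N _ h _) (by lia) B hB
  refine of_ideal (fun I => ?_) M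
  exact (iff_of_dual hτ hB' n (B ⧸ I)).mpr (of_finite_of_injDim hn hR n.lt_succ_self _)

theorem le_of_dual [Nontrivial B] (hn : ringKrullDim R = n)
    (hR : ∀ (M : Type u) [AddCommGroup M] [Module R M], ExtVanish R (t + 1) M R)
    (hτ : Function.Bijective fun b : B => τ ∘ₗ LinearMap.mulRight R b)
    (hB : ∀ j < n, ExtVanish R j (R ⧸ maximalIdeal R) B) {m : ℕ}
    (hm : ∀ (M : Type u) [AddCommGroup M] [Module B M], ExtVanish B (m + 1) M B) : n ≤ m := by
  by_contra! hmn
  have hB' (j : ℕ) : ExtVanish R (j + 1) B R :=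
    of_depth (B := R) (m := n)
      (fun N _ h _ _ _ i hi => @of_finite_of_injDim R _ _ _ n t hn hR i hi N _ h _) (by lia) B hB
  have h0 : ExtVanish R 0 B R := by
    refine of_depth (B := B) (m := m) (fun N _ _ _ _ _ i hi => ?_) (by lia) B hB
    obtain ⟨i, rfl⟩ : ∃ i', i = i' + 1 := ⟨i - 1, by lia⟩
    exact (iff_of_dual hτ hB' i N).mp (of_succ hm N hi)
  exact one_ne_zero (α := B) (eq_of_dual hτ fun c => by rw [zero_iff.mp h0 τ]; rfl)

end Gorenstein

section Localization

variable {R : Type u} [CommRing R] (S : Submonoid R) {A B : Type u} [Ring A] [Ring B]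
  [Algebra R A] [Algebra R B] [Module A B] [IsScalarTower A B B] [IsScalarTower R A B]
  (hS : ∀ s ∈ S, IsUnit (algebraMap R B s))

include hS in
theorem eq_zero_of_smul_eq_zero {Z : Type u} [AddCommGroup Z] [Module R Z] [Module B Z]
    [IsScalarTower R B Z] {s : R} (hs : s ∈ S) {z : Z} (h : s • z = 0) : z = 0 := by
  rw [← algebraMap_smul B s z] at h
  exact ((hS s hs).smul_eq_zero).mp h

variable (hAB : IsLocalizedModule S ((LinearMap.toSpanSingleton A B 1).restrictScalars R))

include hS hAB in
/-- If `Y` is the localization of `X`, then `Ext_A(X, Z) = 0` implies `Ext_B(Y, Z) = 0`. -/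
theorem of_localization {Z : Type u} [AddCommGroup Z] [Module R Z] [Module A Z] [Module B Z]
    [IsScalarTower R A Z] [IsScalarTower R B Z] [IsScalarTower A B Z] {i : ℕ}
    {X Y : Type u} [AddCommGroup X] [Module R X] [Module A X] [IsScalarTower R A X]
    [AddCommGroup Y] [Module R Y] [Module A Y] [Module B Y] [IsScalarTower R A Y]
    [IsScalarTower R B Y] [IsScalarTower A B Y] (f : X →ₗ[A] Y)
    (hsurj : ∀ y, ∃ s ∈ S, ∃ x, s • y = f x) (hinj : ∀ x, f x = 0 → ∃ s ∈ S, s • x = 0)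
    (h : ExtVanish A (i + 1) X Z) : ExtVanish B (i + 1) Y Z := by
  induction i using Nat.strong_induction_on generalizing X Y with | _ i ih => ?_
  let g : (X →₀ A) →ₗ[A] X := Finsupp.linearCombination A id
  have hg : Function.Surjective g := Finsupp.linearCombination_id_surjective A X
  let g' : (X →₀ B) →ₗ[B] Y := Finsupp.linearCombination B f
  let F : (X →₀ A) →ₗ[A] (X →₀ B) :=
    Finsupp.mapRange.linearMap (LinearMap.toSpanSingleton A B 1)
  have hF : ∀ u, g' (F u) = f (g u) := by
    suffices H : (g'.restrictScalars A) ∘ₗ F = f ∘ₗ g from fun u => LinearMap.congr_fun H u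
    ext x
    simp [g, g', F]
  have hg' : Function.Surjective g' := by
    intro y
    obtain ⟨s, hs, x, hx⟩ := hsurj y
    obtain ⟨c, hc⟩ := (hS s hs).exists_left_inv
    refine ⟨c • Finsupp.single x 1, ?_⟩
    rw [map_smul, Finsupp.linearCombination_single, one_smul, ← hx, ← algebraMap_smul B s y,
      ← mul_smul, hc, one_smul]
  have hFloc : IsLocalizedModule S (Finsupp.mapRange.linearMap (α := X)
    ((LinearMap.toSpanSingleton A B 1).restrictScalars R)) := inferInstance
  have hFsurj : ∀ w, ∃ s ∈ S, ∃ u, s • w = F u := fun w => by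
    obtain ⟨⟨u, s⟩, hu⟩ := hFloc.surj w
    exact ⟨s, s.2, u, hu⟩
  have hFinj : ∀ u, F u = 0 → ∃ s ∈ S, s • u = 0 := fun u hu => by
    obtain ⟨s, hs⟩ := hFloc.exists_of_eq (x₁ := u) (x₂ := 0) (by rw [map_zero]; exact hu)
    exact ⟨s, s.2, by rw [smul_zero] at hs; exact hs⟩
  let F' : LinearMap.ker g →ₗ[A] LinearMap.ker g' :=
    (F.comp (LinearMap.ker g).subtype).codRestrict ((LinearMap.ker g').restrictScalars A)
      fun u => by
        change g' (F u) = 0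
        rw [hF, u.2, map_zero]
  have hF'surj : ∀ w, ∃ s ∈ S, ∃ u, s • w = F' u := fun w => by
    obtain ⟨s, hs, u, hu⟩ := hFsurj w
    obtain ⟨t, ht, htu⟩ := hinj (g u) (by
      rw [← hF, ← hu, ← algebraMap_smul B s, map_smul, w.2, smul_zero])
    refine ⟨t * s, S.mul_mem ht hs, ⟨t • u, ?_⟩, Subtype.ext ?_⟩
    · rw [LinearMap.mem_ker, ← algebraMap_smul A t, map_smul, algebraMap_smul, htu]
    · change (t * s) • (w : X →₀ B) = F (t • u)
      rw [mul_smul, hu, ← algebraMap_smul A t, ← algebraMap_smul A t, map_smul]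
  have hF'inj : ∀ u, F' u = 0 → ∃ s ∈ S, s • u = 0 := fun u hu => by
    obtain ⟨s, hs, h0⟩ := hFinj u (congrArg Subtype.val hu)
    exact ⟨s, hs, Subtype.ext h0⟩
  cases i with
  | zero =>
    refine one_of_extension (Submodule.subtype_injective _) (exact_ker g') hg' (of_projective 0)
      fun φ => ?_
    obtain ⟨ψ, hψ⟩ := exists_extension (Submodule.subtype_injective _) (exact_ker g) hg h
      (φ.restrictScalars A ∘ₗ F')
    let ψ' : (X →₀ B) →ₗ[B] Z := Finsupp.linearCombination B fun x => ψ (Finsupp.single x 1)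
    have hψ' : ∀ u, ψ' (F u) = ψ u := by
      suffices H : (ψ'.restrictScalars A) ∘ₗ F = ψ from fun u => LinearMap.congr_fun H u
      ext x
      simp [ψ', F]
    refine ⟨ψ', LinearMap.ext fun w => ?_⟩
    obtain ⟨s, hs, u, hu⟩ := hF'surj w
    rw [← sub_eq_zero]
    apply eq_zero_of_smul_eq_zero S hS hs
    have h₁ : s • φ w = φ (F' u) := by
      rw [← hu, ← algebraMap_smul B s, ← algebraMap_smul B s, map_smul]
    have h₂ : s • ψ' w = ψ' (F u) := by
      rw [show F u = s • (w : X →₀ B) from (congrArg Subtype.val hu).symm,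
        ← algebraMap_smul B s, ← algebraMap_smul B s, map_smul]
    rw [smul_sub, h₁, LinearMap.comp_apply, Submodule.subtype_apply, h₂, hψ', sub_eq_zero]
    exact LinearMap.congr_fun hψ u
  | succ i =>
    exact (shift_iff hg' i).mp
      (ih i i.lt_succ_self F' hF'surj hF'inj ((shift_iff hg i).mpr h))

omit [Module A B] [IsScalarTower A B B] [IsScalarTower R A B] in
include hS in
theorem of_algHom (j : A →ₐ[R] B) (hj : IsLocalizedModule S j.toLinearMap) {g : ℕ}
    (h : ∀ (X Z : Type u) [AddCommGroup X] [AddCommGroup Z] [Module A X] [Module A Z],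
      ExtVanish A (g + 1) X Z)
    (Y Z : Type u) [AddCommGroup Y] [AddCommGroup Z] [Module B Y] [Module B Z] :
    ExtVanish B (g + 1) Y Z := by
  let _ : Module A B := Module.compHom B j.toRingHom
  let _ : Module A Y := Module.compHom Y j.toRingHom
  let _ : Module A Z := Module.compHom Z j.toRingHom
  let _ : Module R Y := Module.compHom Y (algebraMap R B)
  let _ : Module R Z := Module.compHom Z (algebraMap R B)
  have hAB (a : A) (b : B) : a • b = j a * b := rfl
  have hAY (a : A) (b : Y) : a • b = j a • b := rfl
  have hAZ (a : A) (b : Z) : a • b = j a • b := rfl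
  have hRY (a : R) (b : Y) : a • b = algebraMap R B a • b := rfl
  have hRZ (a : R) (b : Z) : a • b = algebraMap R B a • b := rfl
  have : IsScalarTower A B B := ⟨fun a b c => by simp [hAB, mul_assoc]⟩
  have : IsScalarTower R A B := ⟨fun a b c => by simp [hAB]⟩
  have : IsScalarTower R A Y := ⟨fun a b c => by simp [hAY, hRY, Algebra.smul_def, mul_smul]⟩
  have : IsScalarTower R B Y := ⟨fun a b c => by simp [hRY, Algebra.smul_def, mul_smul]⟩
  have : IsScalarTower A B Y := ⟨fun a b c => by simp [hAY, hAB, mul_smul]⟩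
  have : IsScalarTower R A Z := ⟨fun a b c => by simp [hAZ, hRZ, Algebra.smul_def, mul_smul]⟩
  have : IsScalarTower R B Z := ⟨fun a b c => by simp [hRZ, Algebra.smul_def, mul_smul]⟩
  have : IsScalarTower A B Z := ⟨fun a b c => by simp [hAZ, hAB, mul_smul]⟩
  refine of_localization S (A := A) hS ?_ (LinearMap.id : Y →ₗ[A] Y)
    (fun y => ⟨1, S.one_mem, y, one_smul _ _⟩) (fun x hx => ⟨1, S.one_mem, by simpa using hx⟩)
    (h Y Z)
  convert hj
  ext a
  simp [hAB]

end Localization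

theorem iff_of_ringEquiv {A B : Type u} [Ring A] [Ring B] (e : A ≃+* B) (i : ℕ)
    {M N M' N' : Type u} [AddCommGroup M] [AddCommGroup N] [AddCommGroup M'] [AddCommGroup N']
    [Module B M] [Module B N] [Module A M'] [Module A N']
    (φ : M' ≃+ M) (hφ : ∀ (a : A) m, φ (a • m) = e a • φ m)
    (ψ : N' ≃+ N) (hψ : ∀ (a : A) m, ψ (a • m) = e a • ψ m) :
    ExtVanish A i M' N' ↔ ExtVanish B i M N := by
  let F := (ModuleCat.restrictScalarsEquivalenceOfRingEquiv e).functor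
  let _ : Module A M := Module.compHom M e.toRingHom
  let _ : Module A N := Module.compHom N e.toRingHom
  have h := F.mapExt_bijective_of_preservesProjectiveObjects (ModuleCat.of B M)
    (ModuleCat.of B N) i
  have h₁ : ExtVanish A i M N ↔ ExtVanish B i M N :=
    (Equiv.ofBijective _ h).symm.subsingleton_congr
  rw [← h₁]
  let φ' : M' ≃ₗ[A] M := { φ with map_smul' := hφ }
  let ψ' : N' ≃ₗ[A] N := { ψ with map_smul' := hψ }
  exact ⟨ExtVanish.congr φ' ψ', ExtVanish.congr φ'.symm ψ'.symm⟩
end ExtVanish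

theorem Module.End.isIntegral_trace {R K V : Type*} [CommRing R] [Field K] [Algebra R K]
    [AddCommGroup V] [Module K V] [FiniteDimensional K V] [Module R V] [IsScalarTower R K V]
    {f : Module.End K V} (hf : IsIntegral R f) : IsIntegral R (LinearMap.trace K V f) := by
  let b := Module.finBasis K V
  let L := AlgebraicClosure K
  have h := (hf.map ((LinearMap.toMatrixAlgEquiv b).toAlgHom.restrictScalars R)).map
    ((IsScalarTower.toAlgHom R K L).mapMatrix)
  rw [← isIntegral_algebraMap_iff (B := L) (algebraMap K L).injective,
    LinearMap.trace_eq_matrix_trace K b, AddMonoidHom.map_trace (algebraMap K L)]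
  set N := (LinearMap.toMatrix b b f).map (algebraMap K L) with hN
  change IsIntegral R N at h
  change IsIntegral R N.trace
  rw [Matrix.trace_eq_sum_roots_charpoly]
  refine IsIntegral.multiset_sum fun x hx => ?_
  have hx' := Matrix.mem_spectrum_iff_isRoot_charpoly.mpr (Polynomial.isRoot_of_mem_roots hx)
  obtain ⟨p, hp, hp0⟩ := h
  refine ⟨p, hp, ?_⟩
  have h₁ : Polynomial.aeval N (p.map (algebraMap R L)) = 0 := by
    rw [Polynomial.aeval_map_algebraMap]
    exact hp0
  have h₂ := spectrum.subset_polynomial_aeval N (p.map (algebraMap R L)) ⟨x, hx', rfl⟩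
  rw [h₁] at h₂
  have : Nontrivial (Matrix (Fin (Module.finrank K V)) (Fin (Module.finrank K V)) L) := by
    by_contra H
    rw [not_nontrivial_iff_subsingleton] at H
    simp [spectrum.of_subsingleton] at h₂
  rw [spectrum.zero_eq] at h₂
  rw [← Polynomial.eval_map]
  exact h₂

namespace Module.End

variable {R M : Type*} [CommRing R] [IsDomain R] [AddCommGroup M] [Module R M] [Module.Finite R M]

/-- Endomorphisms of a finite module over a normal noetherian domain have a trace in the domain,
computed over the fraction field. -/
theorem exists_trace [IsNoetherianRing R] [IsIntegrallyClosed R] :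
    ∃ τ : Module.End R M →ₗ[R] R, ∀ f, algebraMap R (FractionRing R) (τ f) =
      LinearMap.trace (FractionRing R) _ (f.baseChange (FractionRing R)) := by
  let K := FractionRing R
  let T : Module.End R M →ₗ[R] K :=
    (LinearMap.trace K (K ⊗[R] M)).restrictScalars R ∘ₗ LinearMap.baseChangeHom R K M M
  have hinj : Function.Injective (Algebra.linearMap R K) := IsFractionRing.injective R K
  have hT (f) : T f ∈ LinearMap.range (Algebra.linearMap R K) := by
    have h : IsIntegral R (T f) := Module.End.isIntegral_trace
      ((Algebra.IsIntegral.isIntegral f).map (Module.End.baseChangeHom R K M))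
    exact IsIntegrallyClosed.isIntegral_iff.mp h
  refine ⟨(LinearEquiv.ofInjective _ hinj).symm ∘ₗ T.codRestrict _ hT, fun f => ?_⟩
  exact congrArg Subtype.val ((LinearEquiv.ofInjective _ hinj).apply_symm_apply ⟨T f, hT f⟩)

omit [IsDomain R] in
theorem trace_smulRight_baseChange {K : Type*} [Field K] [Algebra R K] (l : Module.Dual R M)
    (m : M) : LinearMap.trace K _ (LinearMap.baseChange K (l.smulRight m)) =
      algebraMap R K (l m) := by
  have : LinearMap.baseChange K (l.smulRight m) =
      (Module.Dual.baseChange K l).smulRight (1 ⊗ₜ m) := by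
    ext x
    simp [TensorProduct.tmul_smul, TensorProduct.smul_tmul']
  rw [this, LinearMap.trace_smulRight]
  simp [Algebra.smul_def]

/-- A nonzero multiple of the identity of a finite torsion-free module is a sum of maps of
rank one. -/
theorem exists_smul_one_eq_sum [IsNoetherianRing R]
    (hM : Function.Injective (Module.Dual.eval R M)) :
    ∃ r : R, r ≠ 0 ∧ ∃ (n : ℕ) (l : Fin n → Module.Dual R M) (m : Fin n → M),
      (r • 1 : Module.End R M) = ∑ i, (l i).smulRight (m i) := by
  let K := FractionRing R
  let S := nonZeroDivisors R
  let ι := TensorProduct.mk R K M 1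
  have : IsLocalizedModule S ι := inferInstance
  let b := Module.finBasis K (K ⊗[R] M)
  let Φ := IsLocalizedModule.mapExtendScalars S ι (Algebra.linearMap R K) K
  have := Module.finitePresentation_of_finite R M
  have hΦ : IsLocalizedModule S Φ :=
    Module.FinitePresentation.isLocalizedModule_mapExtendScalars S ι (Algebra.linearMap R K) K
  have hΦι (l : Module.Dual R M) (x : M) : Φ l (ι x) = algebraMap R K (l x) :=
    IsLocalizedModule.map_apply S ι (Algebra.linearMap R K) l x
  have hι : Function.Injective ι := by
    rw [injective_iff_map_eq_zero]
    intro x hx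
    obtain ⟨c, hc⟩ := (IsLocalizedModule.eq_zero_iff S ι).mp hx
    refine hM (LinearMap.ext fun l => ?_)
    have h : (c : R) * l x = 0 := by
      rw [← smul_eq_mul, ← map_smul]
      exact (congrArg l hc).trans (map_zero l)
    simpa using (mul_eq_zero.mp h).resolve_left (nonZeroDivisors.ne_zero c.2)
  choose p hp using fun i => hΦ.surj (b.coord i)
  choose q hq using fun i => IsLocalizedModule.surj S ι (b i)
  let s : S := ∏ i, ((p i).2 * (q i).2)
  have hs (i) : ∃ c : S, s = c * ((p i).2 * (q i).2) :=
    (Finset.dvd_prod_of_mem (fun i => (p i).2 * (q i).2) (Finset.mem_univ i)).imp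
      fun c hc => hc.trans (mul_comm _ _)
  choose c hc using hs
  refine ⟨s, nonZeroDivisors.ne_zero s.2, _, fun i => (c i : R) • (p i).1, fun i => (q i).1,
    LinearMap.ext fun x => hι ?_⟩
  simp only [LinearMap.smul_apply, Module.End.one_apply, map_smul, LinearMap.sum_apply, map_sum,
    LinearMap.smulRight_apply]
  conv_lhs => rw [← b.sum_repr (ι x), Finset.smul_sum]
  refine Finset.sum_congr rfl fun i _ => ?_
  have h₁ : ((p i).2 : R) • b.repr (ι x) i = algebraMap R K ((p i).1 x) := by
    rw [← hΦι, ← hp]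
    rfl
  rw [hc i]
  simp only [Submonoid.coe_mul, smul_eq_mul, mul_smul]
  congr 1
  rw [← algebraMap_smul K ((p i).1 x), ← h₁, ← hq i, Submonoid.smul_def, smul_assoc]
  exact congrArg _ (smul_comm _ _ _)

/-- The trace pairing on the endomorphism ring of a reflexive module over a normal noetherian
domain is perfect. -/
theorem exists_trace_bijective [IsNoetherianRing R] [IsIntegrallyClosed R]
    [Module.IsReflexive R M] : ∃ τ : Module.End R M →ₗ[R] R, (∀ f g, τ (f * g) = τ (g * f)) ∧
      Function.Bijective fun g : Module.End R M => τ ∘ₗ LinearMap.mulRight R g := by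
  obtain ⟨τ, hτ⟩ := exists_trace (R := R) (M := M)
  have hinj := IsFractionRing.injective R (FractionRing R)
  have hr (l : Module.Dual R M) (m : M) : τ (l.smulRight m) = l m :=
    hinj ((hτ _).trans (trace_smulRight_baseChange l m))
  have hrefl := Module.bijective_dual_eval R M
  have hmul (l : Module.Dual R M) (m : M) (g : Module.End R M) :
      (l.smulRight m) * g = (l ∘ₗ g).smulRight m := rfl
  refine ⟨τ, fun f g => hinj ?_, fun g g' h => ?_, fun φ => ?_⟩
  · rw [hτ, hτ, LinearMap.baseChange_mul, LinearMap.baseChange_mul, LinearMap.trace_mul_comm]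
  · ext m
    refine hrefl.1 (LinearMap.ext fun l => ?_)
    simpa [hmul, hr] using LinearMap.congr_fun h (l.smulRight m)
  · let ψ : M →ₗ[R] Module.Dual R (Module.Dual R M) :=
      LinearMap.mk₂ R (fun m l => φ (l.smulRight m)) (fun _ _ _ => by
        rw [← map_add]; congr 1; ext; simp) (fun _ _ _ => by
        rw [← map_smul]; congr 1; ext; exact smul_comm _ _ _) (fun _ _ _ => by
        rw [← map_add]; congr 1; ext; simp [add_smul]) (fun _ _ _ => by
        rw [← map_smul]; congr 1; ext; simp [mul_smul])
    let g : Module.End R M := (Module.evalEquiv R M).symm ∘ₗ ψ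
    have hg (l : Module.Dual R M) (m : M) : l (g m) = φ (l.smulRight m) := by
      simp [g, ψ]
    refine ⟨g, LinearMap.ext fun f => ?_⟩
    obtain ⟨r, hr0, n, l, m, hlm⟩ := exists_smul_one_eq_sum hrefl.1
    have hf : r • f = ∑ i, (l i).smulRight (f (m i)) := by
      ext x
      have := congrArg f (LinearMap.congr_fun hlm x)
      simpa using this
    refine mul_left_cancel₀ hr0 ?_
    rw [← smul_eq_mul, ← smul_eq_mul, ← map_smul, ← map_smul, hf]
    simp [hmul, hr, hg]

end Module.End

/-- Perfectness of the pairing attached to a linear form on a finite algebra localizes. -/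
theorem exists_bijective_mulRight_of_isLocalization {R A : Type*} [CommRing R] [Ring A]
    [Algebra R A] [Module.FinitePresentation R A] (S : Submonoid R) (T : Type*) [CommRing T]
    [Algebra R T] [IsLocalization S T] {τ : A →ₗ[R] R}
    (hτ : Function.Bijective fun b : A => τ ∘ₗ LinearMap.mulRight R b) :
    ∃ σ : T ⊗[R] A →ₗ[T] T, Function.Bijective fun b => σ ∘ₗ LinearMap.mulRight T b := by
  let ι := TensorProduct.mk R T A 1
  have : IsLocalizedModule S ι := inferInstance
  let ι' := IsLocalizedModule.mapExtendScalars S ι (Algebra.linearMap R T) T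
  have hι' : IsLocalizedModule S ι' :=
    Module.FinitePresentation.isLocalizedModule_mapExtendScalars S ι (Algebra.linearMap R T) T
  let σ : T ⊗[R] A →ₗ[T] T := ι' τ
  have hσ (a : A) : σ (ι a) = algebraMap R T (τ a) :=
    IsLocalizedModule.map_apply S ι (Algebra.linearMap R T) τ a
  let D : A →ₗ[R] A →ₗ[R] R := (LinearMap.mul R A).flip.compr₂ τ
  let D' : T ⊗[R] A →ₗ[T] T ⊗[R] A →ₗ[T] T := (LinearMap.mul T (T ⊗[R] A)).flip.compr₂ σ
  have hD' : D'.restrictScalars R = IsLocalizedModule.map S ι ι' D := by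
    refine IsLocalizedModule.ext S ι (IsLocalizedModule.map_units ι') (LinearMap.ext fun a => ?_)
    rw [LinearMap.comp_apply, LinearMap.comp_apply, IsLocalizedModule.map_apply]
    apply LinearMap.restrictScalars_injective R
    refine IsLocalizedModule.ext S ι (IsLocalizedModule.map_units (Algebra.linearMap R T))
      (LinearMap.ext fun b => ?_)
    change σ (ι b * ι a) = ι' (D a) (ι b)
    rw [show ι' (D a) (ι b) = algebraMap R T (D a b) from
      IsLocalizedModule.map_apply S ι (Algebra.linearMap R T) (D a) b]
    rw [show ι b * ι a = ι (b * a) by simp [ι], hσ]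
    rfl
  refine ⟨σ, ?_⟩
  change Function.Bijective (D'.restrictScalars R)
  rw [hD']
  exact ⟨IsLocalizedModule.map_injective S ι ι' D hτ.1,
    IsLocalizedModule.map_surjective S ι ι' D hτ.2⟩

theorem sInf_natCast_eq {p : ℕ → Prop} {n : ℕ} (hn : p n) (h : ∀ m, p m → n ≤ m) :
    sInf {d : WithBot (WithTop ℕ) | ∃ m : ℕ, d = ((m : ℕ∞) : WithBot ℕ∞) ∧ p m} =
      ((n : ℕ∞) : WithBot ℕ∞) := by
  refine IsLeast.csInf_eq ⟨⟨n, rfl, hn⟩, ?_⟩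
  rintro _ ⟨m, rfl, hm⟩
  exact WithBot.coe_le_coe.mpr (WithTop.coe_le_coe.mpr (h m hm))

namespace ExtVanish

open IsLocalRing

section Local

variable {R : Type u} [CommRing R] [IsLocalRing R]

theorem of_isMaximalCM {M : Type u} [AddCommGroup M] [Module R M]
    (h : IsMaximalCM R (ModuleCat.of R M)) {n : ℕ} (hn : ringKrullDim R = n) :
    ∀ j < n, ExtVanish R j (R ⧸ maximalIdeal R) M := fun j hj =>
  (subsingleton_extGrp_iff _ _ _).mp (h n hn.ge j hj)

theorem isMaximalCM_congr {M N : Type u} [AddCommGroup M] [Module R M] [AddCommGroup N]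
    [Module R N] (e : M ≃ₗ[R] N) (h : IsMaximalCM R (ModuleCat.of R M)) :
    IsMaximalCM R (ModuleCat.of R N) := fun n hn j hj =>
  (subsingleton_extGrp_iff _ _ _).mpr
    (ExtVanish.congr (.refl _ _) e ((subsingleton_extGrp_iff _ _ _).mp (h n hn j hj)))

variable [IsNoetherianRing R] {B : Type u} [Ring B] [Algebra R B] [Module.Finite R B] {n t : ℕ}
  {τ : B →ₗ[R] R}

theorem globalDimLE_of_dual (hn : ringKrullDim R = n)
    (hR : ∀ (M : Type u) [AddCommGroup M] [Module R M], ExtVanish R (t + 1) M R)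
    (hτ : Function.Bijective fun b : B => τ ∘ₗ LinearMap.mulRight R b)
    (hB : ∀ j < n, ExtVanish R j (R ⧸ maximalIdeal R) B)
    (hg : ∃ g, GlobalDimLE B g) : GlobalDimLE B n := by
  obtain ⟨g, hg⟩ := hg
  have : IsNoetherianRing B :=
    isNoetherian_of_tower R (isNoetherian_of_isNoetherianRing_of_finite R B)
  rw [globalDimLE_iff] at hg ⊢
  exact of_globalDim_of_injDim hg (succ_of_dual hn hR hτ hB)

theorem globalDim_eq_of_dual [Nontrivial B] (hn : ringKrullDim R = n)
    (hR : ∀ (M : Type u) [AddCommGroup M] [Module R M], ExtVanish R (t + 1) M R)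
    (hτ : Function.Bijective fun b : B => τ ∘ₗ LinearMap.mulRight R b)
    (hB : ∀ j < n, ExtVanish R j (R ⧸ maximalIdeal R) B)
    (hg : ∃ g, GlobalDimLE B g) : globalDim B = ((n : ℕ∞) : WithBot ℕ∞) :=
  sInf_natCast_eq (globalDimLE_of_dual hn hR hτ hB hg) fun _ hm =>
    le_of_dual hn hR hτ hB fun _ _ _ => globalDimLE_iff.mp hm _ _

theorem injDim_eq_of_dual [Nontrivial B] (hn : ringKrullDim R = n)
    (hR : ∀ (M : Type u) [AddCommGroup M] [Module R M], ExtVanish R (t + 1) M R)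
    (hτ : Function.Bijective fun b : B => τ ∘ₗ LinearMap.mulRight R b)
    (hB : ∀ j < n, ExtVanish R j (R ⧸ maximalIdeal R) B)
    {X : Type u} [AddCommGroup X] [Module B X] (e : B ≃ₗ[B] X) :
    injDim B (ModuleCat.of B X) = ((n : ℕ∞) : WithBot ℕ∞) :=
  sInf_natCast_eq
    (injDimLE_iff.mpr fun M _ _ => ExtVanish.congr (.refl _ _) e (succ_of_dual hn hR hτ hB M))
    fun _ hm => le_of_dual hn hR hτ hB fun M _ _ =>
      ExtVanish.congr (.refl _ _) e.symm (injDimLE_iff.mp hm M)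

end Local

section Transfer

variable {R : Type u} [CommRing R] [IsLocalRing R]

theorem primeCompl_maximalIdeal_le : (maximalIdeal R).primeCompl ≤ IsUnit.submonoid R :=
  fun x hx => by
    change IsUnit x
    simpa [Ideal.primeCompl] using hx

theorem of_injDimLE_localization {t : ℕ}
    (h : InjDimLE (Localization.AtPrime (maximalIdeal R))
      (ModuleCat.of _ (Localization.AtPrime (maximalIdeal R))) t)
    (M : Type u) [AddCommGroup M] [Module R M] : ExtVanish R (t + 1) M R := by
  let e := IsLocalization.atUnits R (maximalIdeal R).primeCompl
    (S := Localization.AtPrime (maximalIdeal R)) primeCompl_maximalIdeal_le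
  let _ : Module (Localization.AtPrime (maximalIdeal R)) M :=
    Module.compHom M e.symm.toRingEquiv.toRingHom
  refine (iff_of_ringEquiv e.toRingEquiv (t + 1) (AddEquiv.refl M) (fun a m => ?_)
    e.toAddEquiv (fun a m => map_mul e a m)).mpr (injDimLE_iff.mp h M)
  exact congrArg (fun b : R => b • m) (e.symm_apply_apply a).symm

theorem of_isMaximalCMOver {M : Type u} [AddCommGroup M] [Module R M] (h : IsMaximalCMOver R M)
    {n : ℕ} (hn : ringKrullDim R = n) : ∀ j < n, ExtVanish R j (R ⧸ maximalIdeal R) M := by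
  intro j hj
  let Q := Localization.AtPrime (maximalIdeal R)
  let e : R ≃ₐ[R] Q :=
    IsLocalization.atUnits R (maximalIdeal R).primeCompl primeCompl_maximalIdeal_le
  let q := Ideal.quotientEquiv (maximalIdeal R) (maximalIdeal Q) e.toRingEquiv
    (map_ringEquiv_maximalIdeal e.toRingEquiv).symm
  let ι := LocalizedModule.mkLinearMap (maximalIdeal R).primeCompl M
  have hι : Function.Bijective ι := by
    constructor
    · rw [injective_iff_map_eq_zero]
      intro m hm
      obtain ⟨c, hc⟩ := (IsLocalizedModule.eq_zero_iff (maximalIdeal R).primeCompl ι).mp hm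
      exact (primeCompl_maximalIdeal_le c.2).smul_eq_zero.mp hc
    · intro y
      obtain ⟨⟨x, s⟩, hx⟩ := IsLocalizedModule.surj (maximalIdeal R).primeCompl ι y
      obtain ⟨c, hc⟩ := IsUnit.exists_left_inv (primeCompl_maximalIdeal_le s.2)
      exact ⟨c • x, by rw [map_smul, ← hx, Submonoid.smul_def, ← mul_smul, hc, one_smul]⟩
  refine (iff_of_ringEquiv e.toRingEquiv j q.toAddEquiv (fun a m => ?_)
    (AddEquiv.ofBijective ι hι) (fun a m => ?_)).mpr
    (of_isMaximalCM (h _ inferInstance) ((ringKrullDim_eq_of_ringEquiv e.toRingEquiv).symm.trans hn)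
      j hj)
  · obtain ⟨m, rfl⟩ := Ideal.Quotient.mk_surjective m
    exact map_mul q (Ideal.Quotient.mk _ a) (Ideal.Quotient.mk _ m)
  · have : e a = algebraMap R Q a := e.commutes a
    change ι (a • m) = e a • ι m
    rw [this, algebraMap_smul, map_smul]

end Transfer

end ExtVanish

theorem Module.End.nontrivial_tensorProduct_of_isReflexive {R M : Type*} [CommRing R] [IsDomain R]
    [AddCommGroup M] [Module R M] [Module.IsReflexive R M] [Nontrivial M] (S : Submonoid R)
    (hS : S ≤ nonZeroDivisors R) (T : Type*) [CommRing T] [Algebra R T] [IsLocalization S T] :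
    Nontrivial (T ⊗[R] Module.End R M) := by
  have : IsLocalizedModule S (TensorProduct.mk R T (Module.End R M) 1) := inferInstance
  refine ⟨1, 0, fun h => ?_⟩
  obtain ⟨c, hc⟩ := (IsLocalizedModule.eq_zero_iff S (TensorProduct.mk R T (Module.End R M) 1)
    (m := 1)).mp h
  obtain ⟨m, hm⟩ := exists_ne (0 : M)
  have h0 : (c : R) • m = 0 := LinearMap.congr_fun hc m
  exact hm ((smul_eq_zero.mp h0).resolve_left (nonZeroDivisors.ne_zero (hS c.2)))

theorem bijective_mulRight_op {R A : Type*} [CommRing R] [Ring A] [Algebra R A] {τ : A →ₗ[R] R}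
    (hsymm : ∀ a b, τ (a * b) = τ (b * a))
    (hτ : Function.Bijective fun b : A => τ ∘ₗ LinearMap.mulRight R b) :
    Function.Bijective fun b : Aᵐᵒᵖ =>
      (τ ∘ₗ (MulOpposite.opLinearEquiv R).symm.toLinearMap) ∘ₗ LinearMap.mulRight R b := by
  let e := MulOpposite.opLinearEquiv R (M := A)
  have h : (fun b : Aᵐᵒᵖ => (τ ∘ₗ e.symm.toLinearMap) ∘ₗ LinearMap.mulRight R b) =
      (e.arrowCongr (.refl R R)) ∘ (fun b : A => τ ∘ₗ LinearMap.mulRight R b) ∘ e.symm := by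
    ext b a
    exact hsymm _ _
  rw [h]
  exact (e.arrowCongr (.refl R R)).bijective.comp (hτ.comp e.symm.bijective)

theorem GlobalDimLE.of_isLocalization {R A : Type u} [CommRing R] [Ring A] [Algebra R A]
    (S : Submonoid R) (T : Type u) [CommRing T] [Algebra R T] [IsLocalization S T] {g : ℕ}
    (h : GlobalDimLE A g) : GlobalDimLE (T ⊗[R] A) g := by
  rw [ExtVanish.globalDimLE_iff] at h ⊢
  refine fun M X _ _ _ _ => ExtVanish.of_algHom S (fun s hs => ?_)
    Algebra.TensorProduct.includeRight ?_ (fun X Z _ _ _ _ => h X Z) M X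
  · rw [IsScalarTower.algebraMap_apply R T]
    exact (IsLocalization.map_units T ⟨s, hs⟩).map _
  · exact inferInstanceAs (IsLocalizedModule S (TensorProduct.mk R T A 1))

/--
STATEMENT 3: over a normal Gorenstein domain `R`, if `A = End_R(M)` (with `M` a nonzero
reflexive module) has finite global dimension and is a maximal Cohen-Macaulay `R`-module,
then `A` is homologically homogeneous; moreover if `R` is local of dimension `n`, then
`gl.dim A ≤ n` and the global dimension of `A` equals the injective dimension of `A` as
a right `A`-module, which is exactly `n`.
-/
theorem nccr_of_finite_gldim_and_CM
    (k : Type u) [Field k] [IsAlgClosed k] [CharZero k]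
    (R : Type u) [CommRing R] [IsDomain R] [Algebra k R] [IsNoetherianRing R]
    (hnormal : IsIntegrallyClosed R) (hGor : IsGorensteinRing R)
    (M : Type u) [AddCommGroup M] [Module R M] [Module.Finite R M]
    (hrefl : Module.IsReflexive R M) (hM0 : Nontrivial M)
    (hfingldim : ∃ n : ℕ, GlobalDimLE (Module.End R M) n)
    (hCM : IsMaximalCMOver R (Module.End R M)) :
    IsHomologicallyHomogeneous R (Module.End R M) ∧
    (∀ (_ : IsLocalRing R) (n : ℕ), ringKrullDim R = ((n : ℕ∞) : WithBot ℕ∞) →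
      GlobalDimLE (Module.End R M) n ∧
      globalDim (Module.End R M) =
        injDim (Module.End R M)ᵐᵒᵖ (ModuleCat.of (Module.End R M)ᵐᵒᵖ (Module.End R M)) ∧
      injDim (Module.End R M)ᵐᵒᵖ (ModuleCat.of (Module.End R M)ᵐᵒᵖ (Module.End R M)) =
        ((n : ℕ∞) : WithBot ℕ∞)) := by
  obtain ⟨τ, hsymm, hτ⟩ := Module.End.exists_trace_bijective (R := R) (M := M)
  have hfp := Module.finitePresentation_of_finite R (Module.End R M)
  refine ⟨fun P hP => ?_, fun hloc n hn => ?_⟩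
  · have hCMP := ExtVanish.isMaximalCM_congr
      (LocalizedModule.equivTensorProduct P.primeCompl (Module.End R M)) (hCM P hP)
    refine ⟨?_, hCMP⟩
    have := Module.End.nontrivial_tensorProduct_of_isReflexive (R := R) (M := M) P.primeCompl
      P.primeCompl_le_nonZeroDivisors (Localization.AtPrime P)
    have := IsLocalization.isNoetherianRing P.primeCompl (Localization.AtPrime P) inferInstance
    obtain ⟨n, hn⟩ : ∃ n : ℕ, ringKrullDim (Localization.AtPrime P) = n :=
      ⟨_, Order.krullDim_eq_length_of_finiteDimensionalOrder⟩
    obtain ⟨t, ht⟩ := hGor.2 P hP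
    obtain ⟨σ, hσ⟩ := exists_bijective_mulRight_of_isLocalization P.primeCompl
      (Localization.AtPrime P) hτ
    rw [hn]
    exact ExtVanish.globalDim_eq_of_dual hn (ExtVanish.injDimLE_iff.mp ht) hσ
      (ExtVanish.of_isMaximalCM hCMP hn)
      (hfingldim.imp fun g hg => hg.of_isLocalization P.primeCompl _)
  · obtain ⟨t, ht⟩ := hGor.2 (IsLocalRing.maximalIdeal R) inferInstance
    have hR := fun (N : Type u) [AddCommGroup N] [Module R N] =>
      ExtVanish.of_injDimLE_localization ht N
    have hdepth := ExtVanish.of_isMaximalCMOver hCM hn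
    have hinj : injDim (Module.End R M)ᵐᵒᵖ (ModuleCat.of (Module.End R M)ᵐᵒᵖ (Module.End R M)) =
        ((n : ℕ∞) : WithBot ℕ∞) := by
      have hτ' := bijective_mulRight_op hsymm hτ
      refine ExtVanish.injDim_eq_of_dual hn hR hτ' (fun j hj => ExtVanish.congr (.refl _ _)
        (MulOpposite.opLinearEquiv R) (hdepth j hj)) ?_
      exact { MulOpposite.opAddEquiv.symm with map_smul' := fun a b => rfl }
    have hglob := ExtVanish.globalDim_eq_of_dual hn hR hτ hdepth hfingldim
    exact ⟨ExtVanish.globalDimLE_of_dual hn hR hτ hdepth hfingldim, hglob.trans hinj.symm, hinj⟩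

end
end

section
/- Let F: C → E be an exact functor between k-linear triangulated categories possessing a left adjoint and a right adjoint, fitting into a compatible pair of fully faithful functors (D, C) → (F', E) between pairs of triangulated categories admitting relative Serre functors S_C and S_E. Let Ω ⊂ D be a spanning class for C, assume C is nontrivial, E is connected (indecomposable as a triangulated category), F is fully faithful, and S_E F ω ≅ F S_C ω for all ω ∈ Ω. Then F is an equivalence of triangulated categories. -/
open CategoryTheory Limits

noncomputable section

universe v u v₂ u₂

variable (k : Type) [Field k]

/-- A spanning class in a triangulated category: a class of objects `Ω` with
`Ω^⊥ = 0` and `^⊥Ω = 0` (orthogonality with respect to all shifted Homs). -/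
def IsSpanningClass (C : Type u) [Category.{v} C] [HasZeroObject C] [Preadditive C]
    [HasShift C ℤ] (Ω : Set C) : Prop :=
  (∀ c : C, (∀ ω ∈ Ω, ∀ (i : ℤ) (f : ω ⟶ c⟦i⟧), f = 0) → IsZero c) ∧
  (∀ c : C, (∀ ω ∈ Ω, ∀ (i : ℤ) (f : c ⟶ ω⟦i⟧), f = 0) → IsZero c)

/-- A relative Serre functor for a pair `(𝒟, 𝒞)` consisting of a `k`-linear category
`𝒞` and a class of objects `𝒟`: an autoequivalence `S` of `𝒞` preserving `𝒟`,
together with natural isomorphisms `Hom(D, C) ≅ Hom(C, S D)^*` for `D ∈ 𝒟`, `C ∈ 𝒞`. -/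
structure RelativeSerreFunctor (C : Type u) [Category.{v} C] [Preadditive C]
    [Linear k C] (𝒟 : Set C) where
  S : C ⥤ C
  isEquiv : S.IsEquivalence
  preserves : ∀ X ∈ 𝒟, S.obj X ∈ 𝒟
  η : ∀ (X : C), X ∈ 𝒟 → ∀ (Y : C),
    (X ⟶ Y) ≃ₗ[k] Module.Dual k (Y ⟶ S.obj X)
  naturality : ∀ (X : C) (hX : X ∈ 𝒟) (Y Y' : C) (g : Y ⟶ Y') (f : X ⟶ Y)
    (h : Y' ⟶ S.obj X), η X hX Y' (f ≫ g) h = η X hX Y f (g ≫ h)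

/-- A triangulated category is connected (indecomposable) if for any two classes of
objects `A`, `B` with no nonzero morphisms between them in either direction such that
every object is a direct sum of an object of `A` and an object of `B`, either all
objects of `A` or all objects of `B` are zero. -/
def IsConnectedTriangulated (E : Type u₂) [Category.{v₂} E] [HasZeroObject E]
    [Preadditive E] [HasBinaryBiproducts E] : Prop :=
  ∀ A B : Set E,
    (∀ a ∈ A, ∀ b ∈ B, ∀ f : a ⟶ b, f = 0) →
    (∀ a ∈ A, ∀ b ∈ B, ∀ f : b ⟶ a, f = 0) →
    (∀ X : E, ∃ a ∈ A, ∃ b ∈ B, Nonempty (X ≅ a ⊞ b)) →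
    (∀ a ∈ A, IsZero a) ∨ (∀ b ∈ B, IsZero b)

theorem RelativeSerreFunctor.hom_eq_zero_iff {C : Type u} [Category.{v} C] [Preadditive C]
    [Linear k C] {𝒟 : Set C} (S : RelativeSerreFunctor k C 𝒟) {X : C} (hX : X ∈ 𝒟) (Y : C) :
    (∀ f : X ⟶ Y, f = 0) ↔ ∀ g : Y ⟶ S.S.obj X, g = 0 := by
  constructor
  · intro h g
    rw [← Module.forall_dual_apply_eq_zero_iff k]
    intro φ
    obtain ⟨f, rfl⟩ := (S.η X hX Y).surjective φ
    rw [h f, map_zero, LinearMap.zero_apply]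
  · intro h f
    apply (S.η X hX Y).injective
    ext g
    rw [h g, map_zero, map_zero]

section RightOrthogonal

variable {C : Type u} [Category.{v} C] {E : Type u₂} [Category.{v₂} E] [Preadditive E]

/-- The objects of the target receiving only zero morphisms from the image of a functor. -/
def rightOrthogonalOfImage (F : C ⥤ E) : Set E :=
  {Z | ∀ (X : C) (f : F.obj X ⟶ Z), f = 0}

theorem shift_mem_rightOrthogonalOfImage [HasShift C ℤ] [HasShift E ℤ]
    [∀ n : ℤ, (shiftFunctor E n).Additive] (F : C ⥤ E) [F.CommShift ℤ] {Z : E}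
    (hZ : Z ∈ rightOrthogonalOfImage F) (i : ℤ) :
    Z⟦i⟧ ∈ rightOrthogonalOfImage F := by
  intro X f
  obtain ⟨g, hg⟩ := (shiftFunctor E i).map_surjective
    (((F.commShiftIso i).app (X⟦-i⟧)).inv ≫ F.map (shiftNegShift X i).hom ≫ f)
  rw [hZ _ g, Functor.map_zero, eq_comm, ← Category.assoc] at hg
  exact (cancel_epi (((F.commShiftIso i).app (X⟦-i⟧)).inv ≫ F.map (shiftNegShift X i).hom)).1
    (hg.trans comp_zero.symm)

/-- For a full functor commuting with shifts, the cone of the counit of its right adjoint is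
orthogonal to the image. -/
theorem cone_counit_mem_rightOrthogonalOfImage [Preadditive C] [HasShift C ℤ]
    [HasZeroObject E] [HasShift E ℤ] [∀ n : ℤ, (shiftFunctor E n).Additive] [Pretriangulated E]
    {F : C ⥤ E} [F.CommShift ℤ] [F.PreservesZeroMorphisms] [F.Full]
    {H : E ⥤ C} (adj : F ⊣ H) {Y Z : E} {p : Y ⟶ Z} {δ : Z ⟶ (F.obj (H.obj Y))⟦(1 : ℤ)⟧}
    (hT : Pretriangulated.Triangle.mk (adj.counit.app Y) p δ ∈ distTriang E) :
    Z ∈ rightOrthogonalOfImage F := by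
  intro X f
  have hδ : f ≫ δ = 0 := by
    let e : (F.obj (X⟦(-1 : ℤ)⟧))⟦(1 : ℤ)⟧ ≅ F.obj X :=
      ((F.commShiftIso (1 : ℤ)).app (X⟦(-1 : ℤ)⟧)).symm ≪≫ F.mapIso (shiftNegShift X (1 : ℤ))
    obtain ⟨u, hu⟩ := (shiftFunctor E (1 : ℤ)).map_surjective (e.hom ≫ f ≫ δ)
    have hδε : δ ≫ (adj.counit.app Y)⟦(1 : ℤ)⟧' = 0 :=
      Pretriangulated.comp_distTriang_mor_zero₃₁ _ hT
    have huε : u ≫ adj.counit.app Y = 0 := by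
      apply (shiftFunctor E (1 : ℤ)).map_injective
      rw [Functor.map_comp, hu, Category.assoc, Category.assoc, hδε, comp_zero, comp_zero,
        Functor.map_zero]
    have hu0 : u = 0 := by
      obtain ⟨w, rfl⟩ := F.map_surjective u
      have hw : (adj.homEquiv _ _).symm w = (adj.homEquiv _ _).symm 0 := by
        rw [adj.homEquiv_counit, adj.homEquiv_counit, huε, F.map_zero, zero_comp]
      rw [(adj.homEquiv _ _).symm.injective hw]
      exact F.map_zero _ _
    rw [hu0, Functor.map_zero] at hu
    exact (cancel_epi e.hom).1 (hu.symm.trans comp_zero.symm)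
  obtain ⟨g, hg⟩ : ∃ g : F.obj X ⟶ Y, f = g ≫ p :=
    Pretriangulated.Triangle.coyoneda_exact₃ _ hT f hδ
  have hgε : g = F.map (adj.homEquiv _ _ g) ≫ adj.counit.app Y :=
    ((adj.homEquiv X Y).symm_apply_apply g).symm.trans (adj.homEquiv_counit _ _ _)
  have hεp : adj.counit.app Y ≫ p = 0 := Pretriangulated.comp_distTriang_mor_zero₁₂ _ hT
  rw [hg, hgε, Category.assoc, hεp, comp_zero]

end RightOrthogonal

/--
STATEMENT 9: a fully faithful exact functor `F : C → E` between `k`-linear triangulated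
categories, with left and right adjoints, compatible with relative Serre functors on a
spanning class `Ω ⊆ 𝒟`, with `C` nontrivial and `E` connected, is an equivalence.
-/
theorem equivalence_of_fully_faithful_compatible_with_relative_serre
    (C : Type u) [Category.{v} C] [HasZeroObject C] [Preadditive C] [Linear k C]
    [HasShift C ℤ] [∀ n : ℤ, (shiftFunctor C n).Additive] [Pretriangulated C]
    (E : Type u₂) [Category.{v₂} E] [HasZeroObject E] [Preadditive E] [Linear k E]
    [HasShift E ℤ] [∀ n : ℤ, (shiftFunctor E n).Additive] [Pretriangulated E]
    [HasBinaryBiproducts E]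
    (𝒟 : Set C) (ℱ : Set E)
    (F : C ⥤ E) [F.CommShift ℤ] [F.IsTriangulated] [F.Full] [F.Faithful]
    (hcompatPair : ∀ X ∈ 𝒟, F.obj X ∈ ℱ)
    (hleft : ∃ G : E ⥤ C, Nonempty (G ⊣ F))
    (hright : ∃ H : E ⥤ C, Nonempty (F ⊣ H))
    (SC : RelativeSerreFunctor k C 𝒟) (SE : RelativeSerreFunctor k E ℱ)
    (Ω : Set C) (hΩsub : Ω ⊆ 𝒟) (hΩ : IsSpanningClass C Ω)
    (hCnontrivial : ∃ X : C, ¬ IsZero X)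
    (hEconn : IsConnectedTriangulated E)
    (hSerreCompat : ∀ ω ∈ Ω, Nonempty (SE.S.obj (F.obj ω) ≅ F.obj (SC.S.obj ω))) :
    F.IsEquivalence := by
  obtain ⟨G, ⟨adjG⟩⟩ := hleft
  obtain ⟨H, ⟨adjH⟩⟩ := hright
  let _ : G.CommShift ℤ := adjG.leftAdjointCommShift ℤ
  have hG : ∀ Z ∈ rightOrthogonalOfImage F, IsZero (G.obj Z) := by
    intro Z hZ
    refine hΩ.1 _ fun ω hω i => ?_
    obtain ⟨e⟩ := hSerreCompat ω hω
    rw [SC.hom_eq_zero_iff k (hΩsub hω)]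
    intro g
    have hE := (SE.hom_eq_zero_iff k (hcompatPair ω (hΩsub hω)) (Z⟦i⟧)).1
      (shift_mem_rightOrthogonalOfImage F hZ i ω)
    have hg : adjG.homEquiv _ _ ((G.commShiftIso i).hom.app Z ≫ g) = adjG.homEquiv _ _ 0 := by
      rw [← cancel_mono e.inv]
      exact (hE _).trans (hE _).symm
    exact (cancel_epi ((G.commShiftIso i).hom.app Z)).1
      (((adjG.homEquiv _ _).injective hg).trans comp_zero.symm)
  have hleft : ∀ Z ∈ rightOrthogonalOfImage F, ∀ (X : C) (f : Z ⟶ F.obj X), f = 0 :=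
    fun Z hZ X f => (adjG.homEquiv _ _).symm.injective ((hG Z hZ).eq_of_src _ _)
  have hcone : ∀ Y : E, ∃ Z ∈ rightOrthogonalOfImage F, ∃ (p : Y ⟶ Z)
      (δ : Z ⟶ (F.obj (H.obj Y))⟦(1 : ℤ)⟧),
      Pretriangulated.Triangle.mk (adjH.counit.app Y) p δ ∈ distTriang E := by
    intro Y
    obtain ⟨Z, p, δ, hT⟩ := Pretriangulated.distinguished_cocone_triangle (adjH.counit.app Y)
    exact ⟨Z, cone_counit_mem_rightOrthogonalOfImage adjH hT, p, δ, hT⟩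
  have hdecomp := hEconn (Set.range F.obj) (rightOrthogonalOfImage F)
    (by rintro _ ⟨X, rfl⟩ Z hZ f; exact hZ X f)
    (by rintro _ ⟨X, rfl⟩ Z hZ f; exact hleft Z hZ X f) (by
      intro Y
      obtain ⟨Z, hZ, p, δ, hT⟩ := hcone Y
      have hδ : δ = 0 := by
        rw [← cancel_mono ((F.commShiftIso (1 : ℤ)).inv.app (H.obj Y)), zero_comp]
        exact hleft Z hZ _ _
      obtain ⟨e, -⟩ := Pretriangulated.exists_iso_binaryBiproduct_of_distTriang _ hT hδ
      exact ⟨_, ⟨H.obj Y, rfl⟩, Z, hZ, ⟨e⟩⟩)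
  have hzero : ∀ Z ∈ rightOrthogonalOfImage F, IsZero Z := by
    refine hdecomp.resolve_left fun h => ?_
    obtain ⟨X, hX⟩ := hCnontrivial
    refine hX ((IsZero.iff_id_eq_zero X).2 (F.map_injective ?_))
    exact (h _ ⟨X, rfl⟩).eq_of_src _ _
  have : F.EssSurj := ⟨fun Y => by
    obtain ⟨Z, hZ, p, δ, hT⟩ := hcone Y
    have : IsIso (adjH.counit.app Y) :=
      (Pretriangulated.Triangle.isZero₃_iff_isIso₁ _ hT).1 (hzero Z hZ)
    exact ⟨H.obj Y, ⟨asIso (adjH.counit.app Y)⟩⟩⟩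
  exact { }

end
end
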